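/- Let d ≥ 1 and let φ be an admissible weight of growth rate μ ∈ [0,1) with constant c ≥ 1. Then there exist constants C₁, C₂ > 0, depending only on d, μ and c (not on φ itself), such that for every measurable function u : ℝ^d → ℝ one has C₁ · sup_{x̄ ∈ ℝ^d} φ(x̄) ∫_{ℝ^d} |u(x)|² e^{−|x−x̄|} dx ≤ sup_{z ∈ (ℤ/2)^d} φ(z) ∫_{C(z)} |u(x)|² dx ≤ C₂ · sup_{x̄ ∈ ℝ^d} φ(x̄) ∫_{ℝ^d} |u(x)|² e^{−|x−x̄|} dx (the suprema being taken in [0,∞]). In other words, the spaces L²_{b,φ}(ℝ^d) and L̃²_{b,φ}(ℝ^d) coincide and their norms are equivalent. -/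

import Mathlib

open MeasureTheory ENNReal Real

noncomputable section

/-- The closed unit cube of `ℝ^d` centered at `z`. -/
def cube (d : ℕ) (z : EuclideanSpace ℝ (Fin d)) : Set (EuclideanSpace ℝ (Fin d)) :=
  {x | ∀ i, |x i - z i| ≤ 1 / 2}

/-- The half-integer lattice point associated to `ι : Fin d → ℤ`. -/
def latticePt (d : ℕ) (ι : Fin d → ℤ) : EuclideanSpace ℝ (Fin d) :=
  WithLp.toLp 2 fun i => (ι i : ℝ) / 2

lemma measurableSet_cube (d : ℕ) (z : EuclideanSpace ℝ (Fin d)) : MeasurableSet (cube d z) := by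
  have h : cube d z = ⋂ i, {x | |x i - z i| ≤ 1 / 2} := by
    ext x
    simp [cube]
  rw [h]
  refine MeasurableSet.iInter fun i => measurableSet_le ?_ measurable_const
  fun_prop

lemma EuclideanSpace.norm_le_card_of_abs_le_one {d : ℕ} {v : EuclideanSpace ℝ (Fin d)}
    (h : ∀ i, |v i| ≤ 1) : ‖v‖ ≤ d := by
  rw [EuclideanSpace.norm_eq]
  apply Real.sqrt_le_iff.2 ⟨by positivity, ?_⟩
  calc ∑ i, ‖v i‖ ^ 2 ≤ ∑ _i : Fin d, (1 : ℝ) :=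
        Finset.sum_le_sum fun i _ => pow_le_one₀ (norm_nonneg _) (h i)
    _ = d := by simp
    _ ≤ (d : ℝ) ^ 2 := by exact_mod_cast Nat.le_self_pow two_ne_zero d

lemma EuclideanSpace.sum_abs_le_card_mul_norm {d : ℕ} (v : EuclideanSpace ℝ (Fin d)) :
    ∑ i, |v i| ≤ d * ‖v‖ := by
  simpa using Finset.sum_le_card_nsmul Finset.univ (fun i => |v i|) ‖v‖
    fun i _ => PiLp.norm_apply_le v i

lemma norm_sub_le_of_mem_cube {d : ℕ} {x z : EuclideanSpace ℝ (Fin d)} (h : x ∈ cube d z) :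
    ‖x - z‖ ≤ d :=
  EuclideanSpace.norm_le_card_of_abs_le_one fun i => (h i).trans (by norm_num)

lemma exists_mem_cube_latticePt (d : ℕ) (x : EuclideanSpace ℝ (Fin d)) :
    ∃ ι : Fin d → ℤ, x ∈ cube d (latticePt d ι) := by
  refine ⟨fun i => round (2 * x i), fun i => ?_⟩
  have h := abs_le.1 (abs_sub_round (2 * x i))
  simp only [latticePt]
  rw [abs_le]
  constructor <;> linarith [h.1, h.2]

lemma latticePt_sub (d : ℕ) (ι κ : Fin d → ℤ) :
    latticePt d (ι - κ) = latticePt d ι - latticePt d κ := by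
  ext i
  simp [latticePt, sub_div]

lemma summable_prod_apply_of_nonneg {α κ : Type*} [Fintype κ] {f : α → ℝ}
    (hf : Summable f) (hf0 : ∀ a, 0 ≤ f a) : Summable fun p : κ → α => ∏ i, f (p i) := by
  classical
  refine summable_of_sum_le (c := ∏ _i : κ, ∑' a, f a)
    (fun p => Finset.prod_nonneg fun i _ => hf0 _) fun s => ?_
  calc ∑ p ∈ s, ∏ i, f (p i)
      ≤ ∑ p ∈ Fintype.piFinset fun i => s.image fun q => q i, ∏ i, f (p i) := by
        refine Finset.sum_le_sum_of_subset_of_nonneg (fun p hp => ?_)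
          fun p _ _ => Finset.prod_nonneg fun i _ => hf0 _
        exact Fintype.mem_piFinset.2 fun i => Finset.mem_image_of_mem (fun q : κ → α => q i) hp
    _ = ∏ i, ∑ a ∈ s.image fun q => q i, f a := (Finset.prod_univ_sum _ _).symm
    _ ≤ ∏ _i : κ, ∑' a, f a :=
        Finset.prod_le_prod (fun i _ => Finset.sum_nonneg fun a _ => hf0 a)
          fun i _ => hf.sum_le_tsum _ fun a _ => hf0 a

lemma summable_exp_neg_mul_abs_int {a : ℝ} (ha : 0 < a) :
    Summable fun n : ℤ => Real.exp (-a * |(n : ℝ)|) := by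
  have h : Summable fun n : ℕ => Real.exp (-a * n) := by
    simpa [mul_comm] using Real.summable_exp_nat_mul_iff.2 (neg_lt_zero.2 ha)
  refine summable_int_iff_summable_nat_and_neg.2 ⟨?_, ?_⟩ <;> simpa using h

lemma summable_exp_neg_mul_norm_latticePt (d : ℕ) {δ : ℝ} (hδ : 0 < δ) :
    Summable fun ι : Fin d → ℤ => Real.exp (-δ * ‖latticePt d ι‖) := by
  have ha : 0 < δ / (2 * (d + 1)) := by positivity
  refine (summable_prod_apply_of_nonneg (κ := Fin d) (summable_exp_neg_mul_abs_int ha)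
    fun _ => (Real.exp_pos _).le).of_nonneg_of_le (fun _ => (Real.exp_pos _).le) fun ι => ?_
  rw [← Real.exp_sum, Real.exp_le_exp, ← Finset.mul_sum]
  have h := EuclideanSpace.sum_abs_le_card_mul_norm (latticePt d ι)
  simp only [latticePt, abs_div, ← Finset.sum_div, Nat.abs_ofNat] at h
  change _ ≤ d * ‖latticePt d ι‖ at h
  have h0 := norm_nonneg (latticePt d ι)
  have h1 : ∑ i, |(ι i : ℝ)| ≤ 2 * (d + 1) * ‖latticePt d ι‖ := by linarith
  have h2 := mul_le_mul_of_nonneg_left h1 ha.le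
  have h3 : δ / (2 * (d + 1)) * (2 * (d + 1) * ‖latticePt d ι‖) = δ * ‖latticePt d ι‖ := by
    field_simp
  linarith

lemma weight_mul_exp_le {d : ℕ} {μ c : ℝ} (hμ1 : μ < 1) (hc : 0 ≤ c)
    {φ : EuclideanSpace ℝ (Fin d) → ℝ} (hφ0 : ∀ x, 0 < φ x)
    (hφ : ∀ x y, φ x / φ y ≤ c * Real.exp (μ * ‖x - y‖))
    {x y : EuclideanSpace ℝ (Fin d)} {ι κ : Fin d → ℤ}
    (hx : x ∈ cube d (latticePt d ι)) (hy : y ∈ cube d (latticePt d κ)) :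
    φ y * Real.exp (-‖x - y‖) ≤
      c * Real.exp ((2 - μ) * d) * Real.exp (-(1 - μ) * ‖latticePt d (ι - κ)‖) *
        φ (latticePt d ι) := by
  set z := latticePt d ι
  have hxz := norm_sub_le_of_mem_cube hx
  have hyw := norm_sub_le_of_mem_cube hy
  have h1 : φ y ≤ c * Real.exp (μ * ‖y - z‖) * φ z := (div_le_iff₀ (hφ0 z)).1 (hφ y z)
  have h2 : ‖y - z‖ ≤ ‖x - y‖ + d := by
    linarith [norm_sub_le_norm_sub_add_norm_sub y x z, norm_sub_rev x y]
  have h3 : ‖latticePt d (ι - κ)‖ ≤ ‖y - z‖ + d := by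
    rw [latticePt_sub]
    linarith [norm_sub_le_norm_sub_add_norm_sub z y (latticePt d κ), norm_sub_rev y z]
  have h4 := mul_le_mul_of_nonneg_left h3 (sub_nonneg.2 hμ1.le)
  calc φ y * Real.exp (-‖x - y‖)
      ≤ c * Real.exp (μ * ‖y - z‖) * φ z * Real.exp (-‖x - y‖) := by gcongr
    _ = c * Real.exp (μ * ‖y - z‖ + -‖x - y‖) * φ z := by rw [Real.exp_add]; ring
    _ ≤ c * Real.exp ((2 - μ) * d + -(1 - μ) * ‖latticePt d (ι - κ)‖) * φ z := by
        refine mul_le_mul_of_nonneg_right (mul_le_mul_of_nonneg_left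
          (Real.exp_le_exp.2 ?_) hc) (hφ0 z).le
        linarith
    _ = _ := by rw [Real.exp_add]; ring

/-- The exponentially weighted integral is controlled by the supremum over unit cubes. -/
lemma weight_mul_lintegral_exp_le {d : ℕ} {μ c : ℝ} (hμ1 : μ < 1) (hc : 0 ≤ c)
    {φ : EuclideanSpace ℝ (Fin d) → ℝ} (hφ0 : ∀ x, 0 < φ x)
    (hφ : ∀ x y, φ x / φ y ≤ c * Real.exp (μ * ‖x - y‖))
    (u : EuclideanSpace ℝ (Fin d) → ℝ) (y : EuclideanSpace ℝ (Fin d)) :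
    ENNReal.ofReal (φ y) * ∫⁻ x, ENNReal.ofReal (u x ^ 2 * Real.exp (-‖x - y‖)) ≤
      ENNReal.ofReal (c * Real.exp ((2 - μ) * d) *
          ∑' ι : Fin d → ℤ, Real.exp (-(1 - μ) * ‖latticePt d ι‖)) *
        ⨆ ι : Fin d → ℤ, ENNReal.ofReal (φ (latticePt d ι)) *
          ∫⁻ x in cube d (latticePt d ι), ENNReal.ofReal (u x ^ 2) := by
  obtain ⟨κ, hκ⟩ := exists_mem_cube_latticePt d y
  set S := ⨆ ι : Fin d → ℤ, ENNReal.ofReal (φ (latticePt d ι)) *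
    ∫⁻ x in cube d (latticePt d ι), ENNReal.ofReal (u x ^ 2)
  set K := c * Real.exp ((2 - μ) * d)
  have hK : 0 ≤ K := by positivity
  have hcover : ⋃ ι, cube d (latticePt d ι) = Set.univ :=
    Set.eq_univ_of_forall fun x => Set.mem_iUnion.2 (exists_mem_cube_latticePt d x)
  have hterm (ι : Fin d → ℤ) : ∫⁻ x in cube d (latticePt d ι),
      ENNReal.ofReal (φ y) * ENNReal.ofReal (u x ^ 2 * Real.exp (-‖x - y‖)) ≤
        ENNReal.ofReal (K * Real.exp (-(1 - μ) * ‖latticePt d (ι - κ)‖)) * S := by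
    set E := Real.exp (-(1 - μ) * ‖latticePt d (ι - κ)‖)
    have hE : 0 ≤ E := (Real.exp_pos _).le
    calc _ ≤ ∫⁻ x in cube d (latticePt d ι), ENNReal.ofReal (K * E) *
            ENNReal.ofReal (φ (latticePt d ι)) * ENNReal.ofReal (u x ^ 2) := by
          refine setLIntegral_mono' (measurableSet_cube _ _) fun x hx => ?_
          rw [← ENNReal.ofReal_mul (hφ0 _).le, ← ENNReal.ofReal_mul (by positivity),
            ← ENNReal.ofReal_mul (mul_nonneg (by positivity) (hφ0 _).le)]
          refine ENNReal.ofReal_le_ofReal ?_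
          calc φ y * (u x ^ 2 * Real.exp (-‖x - y‖))
              = φ y * Real.exp (-‖x - y‖) * u x ^ 2 := by ring
            _ ≤ _ := mul_le_mul_of_nonneg_right (weight_mul_exp_le hμ1 hc hφ0 hφ hx hκ)
                (sq_nonneg _)
      _ = ENNReal.ofReal (K * E) * (ENNReal.ofReal (φ (latticePt d ι)) *
            ∫⁻ x in cube d (latticePt d ι), ENNReal.ofReal (u x ^ 2)) := by
          rw [lintegral_const_mul' _ _ (by finiteness), mul_assoc]
      _ ≤ _ := by
          gcongr
          exact le_iSup (fun ι : Fin d → ℤ => ENNReal.ofReal (φ (latticePt d ι)) *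
            ∫⁻ x in cube d (latticePt d ι), ENNReal.ofReal (u x ^ 2)) ι
  calc _ = ∫⁻ x in ⋃ ι, cube d (latticePt d ι),
          ENNReal.ofReal (φ y) * ENNReal.ofReal (u x ^ 2 * Real.exp (-‖x - y‖)) := by
        rw [hcover, Measure.restrict_univ, lintegral_const_mul' _ _ (by finiteness)]
    _ ≤ ∑' ι, ∫⁻ x in cube d (latticePt d ι),
          ENNReal.ofReal (φ y) * ENNReal.ofReal (u x ^ 2 * Real.exp (-‖x - y‖)) :=
        lintegral_iUnion_le _ _
    _ ≤ ∑' ι, ENNReal.ofReal (K * Real.exp (-(1 - μ) * ‖latticePt d (ι - κ)‖)) * S :=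
        ENNReal.tsum_le_tsum hterm
    _ = (∑' ι, ENNReal.ofReal (K * Real.exp (-(1 - μ) * ‖latticePt d ι‖))) * S := by
        rw [ENNReal.tsum_mul_right]
        congr 1
        exact (Equiv.subRight κ).tsum_eq
          fun ι => ENNReal.ofReal (K * Real.exp (-(1 - μ) * ‖latticePt d ι‖))
    _ = _ := by
        rw [← ENNReal.ofReal_tsum_of_nonneg (fun ι => by positivity)
          ((summable_exp_neg_mul_norm_latticePt d (sub_pos.2 hμ1)).mul_left K), tsum_mul_left]

/-- The integral over a unit cube is controlled by the exponentially weighted integral. -/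
lemma setLIntegral_cube_le (d : ℕ) (z : EuclideanSpace ℝ (Fin d))
    (u : EuclideanSpace ℝ (Fin d) → ℝ) :
    ∫⁻ x in cube d z, ENNReal.ofReal (u x ^ 2) ≤
      ENNReal.ofReal (Real.exp d) * ∫⁻ x, ENNReal.ofReal (u x ^ 2 * Real.exp (-‖x - z‖)) := by
  rw [← lintegral_const_mul' _ _ (by finiteness)]
  refine (setLIntegral_mono' (measurableSet_cube d z) fun x hx => ?_).trans
    (setLIntegral_le_lintegral _ _)
  rw [← ENNReal.ofReal_mul (Real.exp_pos _).le]
  refine ENNReal.ofReal_le_ofReal ?_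
  have h : 1 ≤ Real.exp d * Real.exp (-‖x - z‖) := by
    rw [← Real.exp_add]
    exact Real.one_le_exp (by linarith [norm_sub_le_of_mem_cube hx])
  linarith [mul_le_mul_of_nonneg_left h (sq_nonneg (u x))]

/-- The spaces `L²_{b,φ}(ℝ^d)` and `L̃²_{b,φ}(ℝ^d)` coincide, with equivalent norms,
for any admissible weight `φ` of growth rate `μ ∈ [0,1)` with constant `c ≥ 1`;
the equivalence constants depend only on `d`, `μ` and `c`. -/
theorem statement0 (d : ℕ) (hd : 1 ≤ d) (μ : ℝ) (hμ0 : 0 ≤ μ) (hμ1 : μ < 1)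
    (c : ℝ) (hc : 1 ≤ c) :
    ∃ C₁ C₂ : ℝ, 0 < C₁ ∧ 0 < C₂ ∧
      ∀ φ : EuclideanSpace ℝ (Fin d) → ℝ, Measurable φ →
        (∃ B : ℝ, ∀ x, φ x ≤ B) → (∀ x, 0 < φ x) →
        (∀ x y : EuclideanSpace ℝ (Fin d),
            c⁻¹ * Real.exp (-μ * ‖x - y‖) ≤ φ x / φ y ∧
            φ x / φ y ≤ c * Real.exp (μ * ‖x - y‖)) →
        ∀ u : EuclideanSpace ℝ (Fin d) → ℝ, Measurable u →
          ENNReal.ofReal C₁ *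
              (⨆ xb : EuclideanSpace ℝ (Fin d), ENNReal.ofReal (φ xb) *
                ∫⁻ x, ENNReal.ofReal (u x ^ 2 * Real.exp (-‖x - xb‖))) ≤
            (⨆ ι : Fin d → ℤ, ENNReal.ofReal (φ (latticePt d ι)) *
              ∫⁻ x in cube d (latticePt d ι), ENNReal.ofReal (u x ^ 2)) ∧
          (⨆ ι : Fin d → ℤ, ENNReal.ofReal (φ (latticePt d ι)) *
              ∫⁻ x in cube d (latticePt d ι), ENNReal.ofReal (u x ^ 2)) ≤
            ENNReal.ofReal C₂ *
              (⨆ xb : EuclideanSpace ℝ (Fin d), ENNReal.ofReal (φ xb) *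
                ∫⁻ x, ENNReal.ofReal (u x ^ 2 * Real.exp (-‖x - xb‖))) := by
  have hc0 : 0 ≤ c := zero_le_one.trans hc
  set K := c * Real.exp ((2 - μ) * d) *
    ∑' ι : Fin d → ℤ, Real.exp (-(1 - μ) * ‖latticePt d ι‖) with hKdef
  have hK : 0 ≤ K := mul_nonneg (by positivity) (tsum_nonneg fun _ => (Real.exp_pos _).le)
  refine ⟨(K + 1)⁻¹, Real.exp d, by positivity, Real.exp_pos _,
    fun φ _ _ hφ0 hφ u _ => ⟨?_, iSup_le fun ι => ?_⟩⟩
  · refine (mul_le_mul_right (iSup_le fun y =>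
      weight_mul_lintegral_exp_le hμ1 hc0 hφ0 (fun x y => (hφ x y).2) u y) _).trans ?_
    rw [← hKdef, ← mul_assoc, ← ENNReal.ofReal_mul (by positivity)]
    refine mul_le_of_le_one_left' (ENNReal.ofReal_le_one.2 ?_)
    rw [inv_mul_le_iff₀ (by positivity)]
    linarith
  · refine (mul_le_mul_right (setLIntegral_cube_le d _ u) _).trans ?_
    rw [mul_left_comm]
    gcongr
    exact le_iSup (fun y => ENNReal.ofReal (φ y) *
      ∫⁻ x, ENNReal.ofReal (u x ^ 2 * Real.exp (-‖x - y‖))) (latticePt d ι)
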